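/- Let 𝒞 be a root class of groups consisting only of periodic groups and let n ∈ ℤ with |n| ≥ 2. Then the following are equivalent: (1) BS(1,n) is conjugacy 𝒞-separable; (2) BS(1,n) is conjugacy 𝓕𝓢_{𝔓(𝒞)}-separable; (3) the set 𝔓(𝒞) contains all prime numbers. -/

import Mathlib

/-- The Baumslag–Solitar relations for `BS(m,n)`: one relation `t⁻¹ aᵐ t a⁻ⁿ`. -/
def BSrels (m n : ℤ) : Set (FreeGroup Bool) :=
  {(FreeGroup.of true)⁻¹ * (FreeGroup.of false) ^ m * FreeGroup.of true *
    (FreeGroup.of false) ^ (-n)}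

/-- The Baumslag–Solitar group `BS(m,n) = ⟨a, t ∣ t⁻¹ aᵐ t = aⁿ⟩`. -/
def BS (m n : ℤ) : Type := PresentedGroup (BSrels m n)

instance (m n : ℤ) : Group (BS m n) :=
  inferInstanceAs (Group (PresentedGroup (BSrels m n)))

/-- The generator `a` of `BS(m,n)`. -/
def BSa (m n : ℤ) : BS m n := PresentedGroup.of false

/-- The generator `t` of `BS(m,n)`. -/
def BSt (m n : ℤ) : BS m n := PresentedGroup.of true

/-- The relations of `H(n,r,s)`: `t⁻¹ a t a⁻ⁿ`, `tʳ`, `aˢ`. -/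
def Hrels (n r s : ℤ) : Set (FreeGroup Bool) :=
  {(FreeGroup.of true)⁻¹ * FreeGroup.of false * FreeGroup.of true * (FreeGroup.of false) ^ (-n),
   (FreeGroup.of true) ^ r, (FreeGroup.of false) ^ s}

/-- The group `H(n,r,s) = ⟨a, t ∣ t⁻¹ a t = aⁿ, tʳ = 1, aˢ = 1⟩`. -/
def Hgrp (n r s : ℤ) : Type := PresentedGroup (Hrels n r s)

instance (n r s : ℤ) : Group (Hgrp n r s) :=
  inferInstanceAs (Group (PresentedGroup (Hrels n r s)))

/-- The generator `a` of `H(n,r,s)`. -/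
def Ha (n r s : ℤ) : Hgrp n r s := PresentedGroup.of false

/-- The generator `t` of `H(n,r,s)`. -/
def Ht (n r s : ℤ) : Hgrp n r s := PresentedGroup.of true

/-- A class of groups: a predicate on (Type-0) groups. -/
def GroupClass : Type 1 := ∀ (G : Type) [Group G], Prop

/-- A class of groups consists only of periodic (torsion) groups. -/
def PeriodicClass (C : GroupClass) : Prop :=
  ∀ (G : Type) [Group G], C G → ∀ g : G, IsOfFinOrder g

/-- `C` is a root class: closed under isomorphism, contains a non-trivial group, closed under
subgroups, extensions and unrestricted direct products `∏_{y ∈ Y} X` with `X, Y ∈ C`. -/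
structure IsRootClass (C : GroupClass) : Prop where
  iso_closed : ∀ (G H : Type) [Group G] [Group H], (G ≃* H) → C G → C H
  has_nontrivial : ∃ (G : Type) (_ : Group G), C G ∧ Nontrivial G
  subgroup_closed : ∀ (G : Type) [Group G] (H : Subgroup G), C G → C H
  extension_closed : ∀ (G : Type) [Group G] (N : Subgroup G) [N.Normal],
    C N → C (G ⧸ N) → C G
  pi_closed : ∀ (X Y : Type) [Group X] [Group Y], C X → C Y → C (Y → X)

/-- `𝔓(C)`: the set of primes dividing the order of some element of some group in `C`. -/
def PrimesOf (C : GroupClass) : Set ℕ :=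
  {p | p.Prime ∧ ∃ (G : Type) (_ : Group G), C G ∧ ∃ g : G, p ∣ orderOf g}

/-- A natural number is a `P`-number: all its prime divisors lie in `P`. -/
def IsPNat (P : Set ℕ) (k : ℕ) : Prop := ∀ p : ℕ, p.Prime → p ∣ k → p ∈ P

/-- An integer is a `P`-number: all its prime divisors lie in `P`. -/
def IsPInt (P : Set ℕ) (k : ℤ) : Prop := ∀ p : ℕ, p.Prime → (p : ℤ) ∣ k → p ∈ P

/-- The class `𝓕_P` of finite groups whose order is a `P`-number. -/
def FClass (P : Set ℕ) (G : Type) [Group G] : Prop :=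
  Finite G ∧ IsPNat P (Nat.card G)

/-- The class `𝓕𝓢_P` of finite solvable groups whose order is a `P`-number. -/
def FSClass (P : Set ℕ) (G : Type) [Group G] : Prop :=
  Finite G ∧ IsSolvable G ∧ IsPNat P (Nat.card G)

/-- `X` is conjugacy `C`-separable. -/
def ConjSep (C : GroupClass) (X : Type) [Group X] : Prop :=
  ∀ x y : X, ¬IsConj x y →
    ∃ (G : Type) (_ : Group G), C G ∧
      ∃ σ : X →* G, Function.Surjective σ ∧ ¬IsConj (σ x) (σ y)

/-- `X` is residually a `C`-group. -/
def ResiduallyIn (C : GroupClass) (X : Type) [Group X] : Prop :=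
  ∀ x y : X, x ≠ y →
    ∃ (G : Type) (_ : Group G), C G ∧
      ∃ σ : X →* G, Function.Surjective σ ∧ σ x ≠ σ y

/-- `X` is residually finite. -/
def ResiduallyFinite (X : Type) [Group X] : Prop :=
  ∀ x y : X, x ≠ y →
    ∃ (G : Type) (_ : Group G), Finite G ∧
      ∃ σ : X →* G, Function.Surjective σ ∧ σ x ≠ σ y

/-- `X` is conjugacy (finite) separable. -/
def ConjugacySeparable (X : Type) [Group X] : Prop :=
  ∀ x y : X, ¬IsConj x y →
    ∃ (G : Type) (_ : Group G), Finite G ∧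
      ∃ σ : X →* G, Function.Surjective σ ∧ ¬IsConj (σ x) (σ y)

/-- `Ξ(n,P)`: positive `P`-numbers `s` such that `n ^ r ≡ 1 (mod s)` for some positive
`P`-number `r`. -/
def Xi (n : ℤ) (P : Set ℕ) : Set ℤ :=
  {s | 0 < s ∧ IsPInt P s ∧ ∃ r : ℤ, 0 < r ∧ IsPInt P r ∧ n ^ r.toNat ≡ 1 [ZMOD s]}

/-- `Ω(n,P)`: pairs `(r,s)` of positive `P`-numbers with `n ^ r ≡ 1 (mod s)`. -/
def OmegaP (n : ℤ) (P : Set ℕ) : Set (ℤ × ℤ) :=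
  {rs | 0 < rs.1 ∧ 0 < rs.2 ∧ IsPInt P rs.1 ∧ IsPInt P rs.2 ∧
    n ^ rs.1.toNat ≡ 1 [ZMOD rs.2]}

theorem zpow_mul_pow_of_semiconj {G : Type*} [Group G] {a t : G} {n : ℤ}
    (h : a * t = t * a ^ n) (b : ℤ) (i : ℕ) : a ^ b * t ^ i = t ^ i * a ^ (b * n ^ i) := by
  have h1 : SemiconjBy t (a ^ n) a := h.symm
  have h2 : ∀ c : ℤ, SemiconjBy t (a ^ (c * n)) (a ^ c) := fun c => by
    have := h1.zpow_right c
    rwa [← zpow_mul, mul_comm] at this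
  induction i with
  | zero => simp
  | succ i ih =>
    have := (h2 (b * n ^ i)).eq
    rw [pow_succ, ← mul_assoc, ih, mul_assoc, ← this, mul_assoc, pow_succ, ← mul_assoc,
      ← mul_assoc b]

theorem inv_pow_mul_zpow_of_semiconj {G : Type*} [Group G] {a t : G} {n : ℤ}
    (h : a * t = t * a ^ n) (b : ℤ) (i : ℕ) :
    (t ^ i)⁻¹ * a ^ b = a ^ (b * n ^ i) * (t ^ i)⁻¹ := by
  rw [eq_mul_inv_iff_mul_eq, mul_assoc, zpow_mul_pow_of_semiconj h, inv_mul_cancel_left]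

namespace BS

variable {n : ℤ}

theorem a_mul_t : BSa 1 n * BSt 1 n = BSt 1 n * BSa 1 n ^ n := by
  have h : (BSt 1 n)⁻¹ * BSa 1 n ^ (1 : ℤ) * BSt 1 n * BSa 1 n ^ (-n) = 1 :=
    PresentedGroup.one_of_mem (rels := BSrels 1 n) (Set.mem_singleton _)
  rw [zpow_one, zpow_neg, mul_inv_eq_one, mul_assoc, inv_mul_eq_iff_eq_mul] at h
  exact h

/-- The homomorphism out of `BS(1,n)` given by images of the generators. -/
def lift {G : Type*} [Group G] (α τ : G) (h : α * τ = τ * α ^ n) : BS 1 n →* G :=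
  PresentedGroup.toGroup (rels := BSrels 1 n) (f := fun b => cond b τ α) <| by
    rintro _ rfl
    simp [h, mul_assoc τ⁻¹]

@[simp]
theorem lift_a {G : Type*} [Group G] (α τ : G) (h : α * τ = τ * α ^ n) :
    lift α τ h (BSa 1 n) = α :=
  PresentedGroup.toGroup.of _

@[simp]
theorem lift_t {G : Type*} [Group G] (α τ : G) (h : α * τ = τ * α ^ n) :
    lift α τ h (BSt 1 n) = τ :=
  PresentedGroup.toGroup.of _

theorem closure_generators : Subgroup.closure {BSa 1 n, BSt 1 n} = ⊤ := by
  have h := PresentedGroup.closure_range_of (BSrels 1 n)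
  have hr : Set.range (PresentedGroup.of : Bool → PresentedGroup (BSrels 1 n)) =
      ({BSa 1 n, BSt 1 n} : Set (BS 1 n)) := by
    ext x
    simp only [Set.mem_range, Bool.exists_bool]
    exact or_congr eq_comm eq_comm
  rw [hr] at h
  exact h

theorem exists_eq (g : BS 1 n) :
    ∃ (i j : ℕ) (b : ℤ), g = BSt 1 n ^ i * BSa 1 n ^ b * (BSt 1 n ^ j)⁻¹ := by
  have hg : g ∈ Subgroup.closure {BSa 1 n, BSt 1 n} := by simp [closure_generators]
  have ha : ∀ (e : ℤ) (y : BS 1 n),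
      (∃ (i j : ℕ) (b : ℤ), y = BSt 1 n ^ i * BSa 1 n ^ b * (BSt 1 n ^ j)⁻¹) →
      ∃ (i j : ℕ) (b : ℤ), BSa 1 n ^ e * y = BSt 1 n ^ i * BSa 1 n ^ b * (BSt 1 n ^ j)⁻¹ := by
    rintro e _ ⟨i, j, b, rfl⟩
    refine ⟨i, j, e * n ^ i + b, ?_⟩
    rw [zpow_add, ← mul_assoc, ← mul_assoc, ← mul_assoc, zpow_mul_pow_of_semiconj a_mul_t]
  induction hg using Subgroup.closure_induction_left with
  | one => exact ⟨0, 0, 0, by simp⟩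
  | mul_left x hx y _ ih =>
    rcases hx with rfl | rfl
    · simpa using ha 1 y ih
    · obtain ⟨i, j, b, rfl⟩ := ih
      exact ⟨i + 1, j, b, by simp only [pow_succ', mul_assoc]⟩
  | inv_mul_cancel x hx y _ ih =>
    rcases hx with rfl | rfl
    · simpa using ha (-1) y ih
    · obtain ⟨i, j, b, rfl⟩ := ih
      cases i with
      | zero =>
        refine ⟨0, j + 1, b * n, ?_⟩
        have h := inv_pow_mul_zpow_of_semiconj (a_mul_t (n := n)) b 1
        rw [pow_one, pow_one] at h
        rw [pow_zero, one_mul, one_mul, ← mul_assoc, h, pow_succ, mul_inv_rev, mul_assoc]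
      | succ i => exact ⟨i, j, b, by simp only [pow_succ', mul_assoc, inv_mul_cancel_left]⟩

theorem exists_isConj (g : BS 1 n) :
    ∃ (k b : ℤ), IsConj g (BSt 1 n ^ k * BSa 1 n ^ b) := by
  obtain ⟨i, j, b, rfl⟩ := exists_eq g
  refine ⟨i - j, b, isConj_iff.2 ⟨(BSt 1 n ^ j)⁻¹, ?_⟩⟩
  rw [sub_eq_neg_add, zpow_add, zpow_neg, zpow_natCast, zpow_natCast]
  group

theorem isConj_mul_pow (k b : ℤ) (i : ℕ) :
    IsConj (BSt 1 n ^ k * BSa 1 n ^ b) (BSt 1 n ^ k * BSa 1 n ^ (b * n ^ i)) := by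
  refine isConj_iff.2 ⟨(BSt 1 n ^ i)⁻¹, ?_⟩
  rw [inv_inv, mul_assoc, mul_assoc, zpow_mul_pow_of_semiconj a_mul_t]
  group

theorem isConj_add_mul (k : ℕ) (b d : ℤ) :
    IsConj (BSt 1 n ^ k * BSa 1 n ^ b) (BSt 1 n ^ k * BSa 1 n ^ (b + d * (n ^ k - 1))) := by
  refine isConj_iff.2 ⟨BSa 1 n ^ d, ?_⟩
  rw [← mul_assoc, zpow_mul_pow_of_semiconj a_mul_t, mul_assoc, mul_assoc, ← zpow_neg, ← zpow_add,
    ← zpow_add]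
  congr 2
  ring

theorem isConj_inv_add_mul (k : ℕ) (b d : ℤ) :
    IsConj ((BSt 1 n ^ k)⁻¹ * BSa 1 n ^ b)
      ((BSt 1 n ^ k)⁻¹ * BSa 1 n ^ (b + d * (n ^ k - 1))) := by
  refine isConj_iff.2 ⟨BSa 1 n ^ (-(d * n ^ k)), ?_⟩
  rw [← mul_assoc, ← neg_mul, ← inv_pow_mul_zpow_of_semiconj a_mul_t, mul_assoc, mul_assoc,
    ← zpow_neg, ← zpow_add, ← zpow_add]
  congr 2
  ring

theorem isConj_of_modEq {k b c : ℤ} {i : ℕ} (h : b * n ^ i ≡ c [ZMOD n ^ k.natAbs - 1]) :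
    IsConj (BSt 1 n ^ k * BSa 1 n ^ b) (BSt 1 n ^ k * BSa 1 n ^ c) := by
  refine (isConj_mul_pow k b i).trans ?_
  obtain ⟨d, hd⟩ := h.dvd
  obtain rfl : c = b * n ^ i + d * (n ^ k.natAbs - 1) := by linarith
  rcases Int.natAbs_eq k with hk | hk
  · rw [hk, zpow_natCast, Int.natAbs_natCast]
    exact isConj_add_mul _ _ _
  · rw [hk, zpow_neg, zpow_natCast, Int.natAbs_neg, Int.natAbs_natCast]
    exact isConj_inv_add_mul _ _ _

/-- The exponent sum of `t`. -/
def height (m : ℕ) : BS 1 n →* Multiplicative (ZMod m) :=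
  lift 1 (Multiplicative.ofAdd 1) (by simp)

instance isSolvable : Group.IsSolvable (BS 1 n) := by
  have hcomm : ∀ (i j : ℕ), i ≤ j → ∀ b c : ℤ, Commute
      (BSt 1 n ^ i * BSa 1 n ^ b * (BSt 1 n ^ i)⁻¹)
      (BSt 1 n ^ j * BSa 1 n ^ c * (BSt 1 n ^ j)⁻¹) := by
    rintro i j hij b c
    obtain ⟨d, rfl⟩ := Nat.exists_eq_add_of_le hij
    have h : BSt 1 n ^ i * BSa 1 n ^ b * (BSt 1 n ^ i)⁻¹ =
        BSt 1 n ^ (i + d) * BSa 1 n ^ (b * n ^ d) * (BSt 1 n ^ (i + d))⁻¹ := by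
      rw [pow_add, mul_assoc (_ ^ i) (_ ^ d), ← zpow_mul_pow_of_semiconj a_mul_t]
      group
    rw [h, ← MulAut.conj_apply, ← MulAut.conj_apply]
    exact ((Commute.refl _).zpow_zpow _ _).map (MulAut.conj (BSt 1 n ^ (i + d)))
  have : Group.IsSolvable (height (n := n) 0).ker := by
    refine Group.isSolvable_of_comm ?_
    have hker : ∀ x ∈ (height (n := n) 0).ker,
        ∃ (i : ℕ) (b : ℤ), x = BSt 1 n ^ i * BSa 1 n ^ b * (BSt 1 n ^ i)⁻¹ := by
      intro x hx
      obtain ⟨i, j, b, rfl⟩ := exists_eq x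
      have : i = j := by
        rw [MonoidHom.mem_ker] at hx
        have := congrArg Multiplicative.toAdd hx
        simp [height, ← sub_eq_add_neg, sub_eq_zero] at this
        exact this
      exact ⟨i, b, by rw [this]⟩
    rintro ⟨x, hx⟩ ⟨y, hy⟩
    obtain ⟨i, b, rfl⟩ := hker x hx
    obtain ⟨j, c, rfl⟩ := hker y hy
    ext1
    rcases le_total i j with h | h
    · exact (hcomm i j h b c).eq
    · exact (hcomm j i h c b).eq.symm
  exact Group.isSolvable_of_ker_le_range (height (n := n) 0).ker.subtype (height 0) (by simp)

theorem finite_of_isOfFinOrder {G : Type*} [Group G] {σ : BS 1 n →* G}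
    (hσ : Function.Surjective σ) (h : ∀ g : G, IsOfFinOrder g) : Finite G := by
  have (g : G) : Finite (Subgroup.zpowers g) := (h g).finite_zpowers
  refine Finite.of_surjective
    (fun x : Subgroup.zpowers (σ (BSt 1 n)) × Subgroup.zpowers (σ (BSa 1 n)) ×
      Subgroup.zpowers (σ (BSt 1 n)) => (x.1 * x.2.1 * x.2.2 : G)) fun g => ?_
  obtain ⟨g, rfl⟩ := hσ g
  obtain ⟨i, j, b, rfl⟩ := exists_eq g
  refine ⟨⟨⟨σ (BSt 1 n) ^ i, i, by simp⟩, ⟨σ (BSa 1 n) ^ b, b, rfl⟩,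
    ⟨(σ (BSt 1 n) ^ j)⁻¹, -j, by simp⟩⟩, by simp⟩

section Affine

variable (n) {m : ℕ} (hm : m ≠ 0)

theorem intCast_pow_eq_one (n : ℤ) (m : ℕ) : (n : ZMod (n ^ m - 1).natAbs) ^ m = 1 := by
  have h : ((n ^ m - 1 : ℤ) : ZMod (n ^ m - 1).natAbs) = 0 := by
    rw [ZMod.intCast_zmod_eq_zero_iff_dvd, Int.natAbs_dvd]
  push_cast at h
  exact sub_eq_zero.1 h

/-- The action of `BS(1,n)` on `ℤ/(nᵐ - 1)`, with `a` a translation and `t⁻¹` the multiplication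
by `n`. -/
def affine : BS 1 n →* Equiv.Perm (ZMod (n ^ m - 1).natAbs) :=
  lift (Equiv.addRight 1)
    (Units.mulLeft (Units.ofPowEqOne (n : ZMod (n ^ m - 1).natAbs) m (intCast_pow_eq_one n m) hm))⁻¹
    (by
      ext1 z
      rw [Equiv.Perm.mul_apply, Equiv.Perm.mul_apply, eq_comm, Equiv.Perm.inv_eq_iff_eq,
        Equiv.zsmul_addRight]
      set u := Units.ofPowEqOne (n : ZMod (n ^ m - 1).natAbs) m (intCast_pow_eq_one n m) hm with hu
      have h : Units.mulLeft u ((Units.mulLeft u)⁻¹ z) = z := Equiv.apply_symm_apply _ z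
      simp only [Units.mulLeft_apply, Equiv.coe_addRight, mul_add] at h ⊢
      rw [h, hu]
      simp)

theorem affine_a_zpow_apply (b : ℤ) (z : ZMod (n ^ m - 1).natAbs) :
    affine n hm (BSa 1 n ^ b) z = z + b := by
  simp [affine]

theorem affine_t_inv_pow_apply (j : ℕ) (z : ZMod (n ^ m - 1).natAbs) :
    affine n hm (BSt 1 n ^ j)⁻¹ z = n ^ j * z := by
  have h : affine n hm (BSt 1 n)⁻¹ = Units.mulLeft
      (Units.ofPowEqOne (n : ZMod (n ^ m - 1).natAbs) m (intCast_pow_eq_one n m) hm) := by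
    simp [affine]
  rw [← inv_pow, map_pow, h]
  induction j with
  | zero => simp
  | succ j ih => rw [pow_succ', Equiv.Perm.mul_apply, ih, Units.mulLeft_apply,
      Units.val_ofPowEqOne, pow_succ', mul_assoc]

theorem affine_t_zpow {k : ℤ} (hk : (m : ℤ) ∣ k) : affine n hm (BSt 1 n ^ k) = 1 := by
  obtain ⟨l, rfl⟩ := hk
  have h : affine n hm (BSt 1 n ^ m)⁻¹ = 1 := by
    ext1 z
    rw [affine_t_inv_pow_apply, intCast_pow_eq_one, one_mul, Equiv.Perm.one_apply]
  rw [zpow_mul, zpow_natCast, map_zpow, ← inv_inv (BSt 1 n ^ m), map_inv, h, inv_one, one_zpow]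

theorem exists_affine_apply (g : BS 1 n) :
    ∃ (e : ℕ) (d : ZMod (n ^ m - 1).natAbs), ∀ z, affine n hm g z = n ^ e * z + d := by
  obtain ⟨i, j, b, rfl⟩ := exists_eq g
  have hi : affine n hm (BSt 1 n ^ i) = affine n hm (BSt 1 n ^ ((m - 1) * i))⁻¹ := by
    have h : BSt 1 n ^ i = BSt 1 n ^ ((m * i : ℕ) : ℤ) * (BSt 1 n ^ ((m - 1) * i))⁻¹ := by
      rw [zpow_natCast, eq_mul_inv_iff_mul_eq, ← pow_add, ← one_add_mul,
        Nat.add_sub_cancel' (Nat.one_le_iff_ne_zero.2 hm)]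
    rw [h, map_mul, affine_t_zpow n hm (by simp), one_mul]
  refine ⟨(m - 1) * i + j, n ^ ((m - 1) * i) * b, fun z => ?_⟩
  rw [map_mul, map_mul, hi, Equiv.Perm.mul_apply, Equiv.Perm.mul_apply, affine_t_inv_pow_apply,
    affine_t_inv_pow_apply, affine_a_zpow_apply, pow_add]
  ring

theorem exists_modEq_of_affine_conj {k b c : ℤ} (hk : (m : ℤ) ∣ k) {g : BS 1 n}
    (h : affine n hm g * affine n hm (BSt 1 n ^ k * BSa 1 n ^ b) * (affine n hm g)⁻¹ =
      affine n hm (BSt 1 n ^ k * BSa 1 n ^ c)) :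
    ∃ e : ℕ, b * n ^ e ≡ c [ZMOD n ^ m - 1] := by
  obtain ⟨e, d, hd⟩ := exists_affine_apply n hm g
  refine ⟨e, ?_⟩
  rw [map_mul, map_mul, affine_t_zpow n hm hk, one_mul, one_mul, mul_inv_eq_iff_eq_mul] at h
  have h0 := DFunLike.congr_fun h 0
  rw [Equiv.Perm.mul_apply, Equiv.Perm.mul_apply, affine_a_zpow_apply, affine_a_zpow_apply, hd, hd,
    zero_add, mul_zero, zero_add, add_comm, add_left_cancel_iff] at h0
  have h1 : ((b * n ^ e : ℤ) : ZMod (n ^ m - 1).natAbs) = (c : ℤ) := by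
    push_cast
    rw [mul_comm, h0]
  rwa [ZMod.intCast_eq_intCast_iff_dvd_sub, Int.natAbs_dvd, ← Int.modEq_iff_dvd] at h1

end Affine

end BS

theorem pow_sub_one_ne_zero_of_two_le_abs {n : ℤ} (hn : 2 ≤ |n|) {m : ℕ} (hm : m ≠ 0) :
    n ^ m - 1 ≠ 0 := by
  intro h
  have h1 : |n| ^ m = 1 := by rw [← abs_pow, sub_eq_zero.1 h, abs_one]
  have := one_lt_pow₀ (show 1 < |n| by linarith) hm
  omega

theorem mul_pow_eq_of_modEq {n b c : ℤ} {M r : ℕ} (hn : 2 ≤ |n|) (hr : r ≤ M)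
    (hM : |b| + |c| + 1 < |n| ^ M) (h : b * n ^ r ≡ c [ZMOD n ^ (2 * M) - 1]) :
    b * n ^ r = c := by
  refine (sub_eq_zero.1 (Int.eq_zero_of_abs_lt_dvd h.dvd ?_)).symm
  have h1 : |n| ^ r ≤ |n| ^ M := pow_le_pow_right₀ (by linarith) hr
  have h2 : |c - b * n ^ r| ≤ |c| + |b| * |n| ^ r := by
    rw [← abs_pow, ← abs_mul]
    exact abs_sub _ _
  have h3 : |n| ^ M * |n| ^ M = n ^ (2 * M) := by
    rw [← abs_pow, abs_mul_abs_self]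
    ring
  have h4 := abs_nonneg b
  have h5 := abs_nonneg c
  rw [← h3]
  nlinarith [mul_le_mul_of_nonneg_left h1 h4, abs_nonneg (c - b * n ^ r)]

theorem exists_forall_not_modEq {n b c : ℤ} (hn : 2 ≤ |n|) (h : ∀ i : ℕ, b * n ^ i ≠ c)
    (h' : ∀ i : ℕ, c * n ^ i ≠ b) :
    ∃ m : ℕ, m ≠ 0 ∧ ∀ e : ℕ, ¬b * n ^ e ≡ c [ZMOD n ^ m - 1] := by
  obtain ⟨M, hM⟩ := pow_unbounded_of_one_lt (|b| + |c| + 1) (show 1 < |n| by linarith)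
  have hM0 : M ≠ 0 := by
    rintro rfl
    have h4 := abs_nonneg b
    have h5 := abs_nonneg c
    rw [pow_zero] at hM
    linarith
  refine ⟨2 * M, by positivity, fun e he => ?_⟩
  have h1 : n ^ (2 * M) ≡ 1 [ZMOD n ^ (2 * M) - 1] := (Int.modEq_sub _ _)
  have hr : e % (2 * M) < 2 * M := Nat.mod_lt _ (by positivity)
  have he' : b * n ^ (e % (2 * M)) ≡ c [ZMOD n ^ (2 * M) - 1] := by
    refine Int.ModEq.trans ?_ he
    conv_rhs => rw [← Nat.div_add_mod e (2 * M), pow_add, pow_mul]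
    simpa using ((h1.symm.pow (e / (2 * M))).mul_right (n ^ (e % (2 * M)))).mul_left b
  rcases le_or_gt (e % (2 * M)) M with hle | hgt
  · exact h _ (mul_pow_eq_of_modEq hn hle hM he')
  · refine h' (2 * M - e % (2 * M)) (mul_pow_eq_of_modEq hn (M := M) (by omega) (by linarith) ?_)
    refine (he'.symm.mul_right _).trans ?_
    rw [mul_assoc, ← pow_add, Nat.add_sub_cancel' hr.le]
    simpa using h1.mul_left b

namespace BS

variable {n : ℤ} {P : Set ℕ}

theorem exists_fsClass_not_isConj (hP : ∀ p : ℕ, p.Prime → p ∈ P) {H : Type} [Group H] [Finite H]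
    (σ : BS 1 n →* H) {x y x' y' : BS 1 n} (hx : IsConj x x') (hy : IsConj y y')
    (h : ∀ g, σ g * σ x' * (σ g)⁻¹ ≠ σ y') :
    ∃ (G : Type) (_ : Group G), FSClass P G ∧
      ∃ τ : BS 1 n →* G, Function.Surjective τ ∧ ¬IsConj (τ x) (τ y) := by
  refine ⟨σ.range, inferInstance, ⟨inferInstance,
    Group.isSolvable_of_surjective σ.rangeRestrict_surjective, fun p hp _ => hP p hp⟩,
    σ.rangeRestrict, σ.rangeRestrict_surjective, fun hc => ?_⟩
  have hc' := ((σ.rangeRestrict.map_isConj hx).symm.trans hc).trans (σ.rangeRestrict.map_isConj hy)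
  obtain ⟨⟨_, g, rfl⟩, hg⟩ := isConj_iff.1 hc'
  exact h g (congrArg Subtype.val hg)

theorem conjSep_fsClass (hn : 2 ≤ |n|) (hP : ∀ p : ℕ, p.Prime → p ∈ P) :
    ConjSep (FSClass P) (BS 1 n) := by
  intro x y hxy
  obtain ⟨k, b, hx⟩ := exists_isConj x
  obtain ⟨l, c, hy⟩ := exists_isConj y
  by_cases hkl : k = l
  · subst hkl
    have hconj : ∀ {b' c' : ℤ} {i : ℕ}, b' * n ^ i ≡ c' [ZMOD n ^ k.natAbs - 1] →
        (b' = b ∧ c' = c ∨ b' = c ∧ c' = b) → False := by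
      rintro b' c' i h (⟨rfl, rfl⟩ | ⟨rfl, rfl⟩)
      · exact hxy ((hx.trans (isConj_of_modEq h)).trans hy.symm)
      · exact hxy ((hx.trans (isConj_of_modEq h).symm).trans hy.symm)
    obtain ⟨m, hm, hmk, h⟩ : ∃ m : ℕ, m ≠ 0 ∧ (m : ℤ) ∣ k ∧
        ∀ e : ℕ, ¬b * n ^ e ≡ c [ZMOD n ^ m - 1] := by
      by_cases hk : k = 0
      · obtain ⟨m, hm, h⟩ := exists_forall_not_modEq (b := b) (c := c) hn
          (fun i hi => hconj (i := i) (hi ▸ Int.ModEq.refl _) (.inl ⟨rfl, rfl⟩))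
          (fun i hi => hconj (i := i) (hi ▸ Int.ModEq.refl _) (.inr ⟨rfl, rfl⟩))
        exact ⟨m, hm, hk ▸ dvd_zero _, h⟩
      · exact ⟨k.natAbs, Int.natAbs_ne_zero.2 hk, Int.natAbs_dvd.2 dvd_rfl,
          fun e he => hconj he (.inl ⟨rfl, rfl⟩)⟩
    have : NeZero (n ^ m - 1).natAbs :=
      ⟨Int.natAbs_ne_zero.2 (pow_sub_one_ne_zero_of_two_le_abs hn hm)⟩
    refine exists_fsClass_not_isConj hP (affine n hm) hx hy fun g hg => ?_
    obtain ⟨e, he⟩ := exists_modEq_of_affine_conj n hm hmk hg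
    exact h e he
  · refine exists_fsClass_not_isConj (H := Multiplicative (ZMod ((k - l).natAbs + 1))) hP
      (height _) hx hy fun g hg => hkl ?_
    rw [mul_inv_eq_iff_eq_mul, mul_comm, mul_right_cancel_iff] at hg
    have h1 := congrArg Multiplicative.toAdd hg
    have h2 : ((k : ℤ) : ZMod ((k - l).natAbs + 1)) = (l : ℤ) := by
      simpa [height] using h1
    rw [ZMod.intCast_eq_intCast_iff_dvd_sub] at h2
    have h3 := Int.eq_zero_of_abs_lt_dvd h2 (by rw [abs_sub_comm, Int.abs_eq_natAbs]; omega)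
    linarith

theorem dvd_orderOf_of_conjSep (hn : 2 ≤ |n|) (h : ConjSep (FSClass P) (BS 1 n)) {q : ℕ}
    (hq : q.Prime) (hqn : ¬(q : ℤ) ∣ n) :
    ∃ (G : Type) (_ : Group G), FSClass P G ∧ ∃ σ : BS 1 n →* G, q ∣ orderOf (σ (BSa 1 n)) := by
  have := Fact.mk hq
  have hk : q - 1 ≠ 0 := (Nat.sub_pos_of_lt hq.one_lt).ne'
  obtain ⟨u, hu⟩ : (q : ℤ) ∣ n ^ (q - 1) - 1 := by
    have hnq : (n : ZMod q) ≠ 0 := by rwa [Ne, ZMod.intCast_zmod_eq_zero_iff_dvd]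
    rw [← ZMod.intCast_zmod_eq_zero_iff_dvd]
    push_cast
    rw [ZMod.pow_card_sub_one_eq_one hnq, sub_self]
  have hu0 : u ≠ 0 := by
    rintro rfl
    exact pow_sub_one_ne_zero_of_two_le_abs hn hk (by simpa using hu)
  have hnc : ¬IsConj (BSt 1 n ^ ((q - 1 : ℕ) : ℤ) * BSa 1 n ^ (0 : ℤ))
      (BSt 1 n ^ ((q - 1 : ℕ) : ℤ) * BSa 1 n ^ u) := by
    intro hc
    obtain ⟨g, hg⟩ := isConj_iff.1 hc
    obtain ⟨e, he⟩ := exists_modEq_of_affine_conj n hk dvd_rfl (b := 0) (c := u) (g := g)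
      (by rw [← map_mul, ← map_inv, ← map_mul, hg])
    have hd := he.dvd
    rw [zero_mul, sub_zero, hu] at hd
    have h1 := Int.eq_one_of_dvd_one (by positivity)
      ((mul_dvd_mul_iff_right hu0).1 (hd.trans (one_mul u).symm.dvd))
    exact hq.one_lt.ne' (by exact_mod_cast h1)
  obtain ⟨G, _, hG, σ, -, hσ⟩ := h _ _ hnc
  refine ⟨G, _, hG, σ, by_contra fun hqs => hσ ?_⟩
  obtain ⟨e, f, hef⟩ : IsCoprime (q : ℤ) (orderOf (σ (BSa 1 n)) : ℤ) :=
    Nat.isCoprime_iff_coprime.2 ((Nat.Prime.coprime_iff_not_dvd hq).2 hqs)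
  have hc := σ.map_isConj (isConj_add_mul (n := n) (q - 1) 0 (e * 1))
  convert hc using 1
  · simp
  · rw [hu, map_mul, map_mul, zpow_natCast, map_zpow, map_zpow]
    congr 1
    rw [← zpow_mod_orderOf, ← zpow_mod_orderOf _ (0 + _)]
    congr 1
    refine (Int.modEq_iff_dvd.2 ⟨-f * u, ?_⟩)
    linear_combination u * hef

theorem prime_mem_of_conjSep (hn : 2 ≤ |n|) (h : ConjSep (FSClass P) (BS 1 n)) {p : ℕ}
    (hp : p.Prime) : p ∈ P := by
  by_cases hpn : (p : ℤ) ∣ n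
  · obtain ⟨q, hq, hqd⟩ := Nat.exists_prime_and_dvd (n := ∑ i ∈ Finset.range p, (n.natAbs ^ 2) ^ i)
      (by
        have h1 : ∑ i ∈ Finset.range 2, (n.natAbs ^ 2) ^ i ≤
            ∑ i ∈ Finset.range p, (n.natAbs ^ 2) ^ i :=
          Finset.sum_le_sum_of_subset (Finset.range_mono hp.two_le)
        have h2 : n ≠ 0 := by rintro rfl; simp at hn
        have h3 := Int.natAbs_pos.2 h2
        simp only [Finset.sum_range_succ, Finset.range_zero, Finset.sum_empty, pow_zero, pow_one]
          at h1
        have : 0 < n.natAbs ^ 2 := by positivity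
        omega)
    have := Fact.mk hq
    have hsum : ∑ i ∈ Finset.range p, ((n : ZMod q) ^ 2) ^ i = 0 := by
      have h1 := (ZMod.natCast_eq_zero_iff _ q).2 hqd
      have h2 : ((n.natAbs : ℕ) : ZMod q) ^ 2 = (n : ZMod q) ^ 2 := by
        have := congrArg (Int.cast : ℤ → ZMod q) (Int.natAbs_sq n)
        push_cast at this ⊢
        simpa using this
      push_cast at h1
      rwa [h2] at h1
    have hqn : ¬(q : ℤ) ∣ n := by
      intro hd
      rw [← ZMod.intCast_zmod_eq_zero_iff_dvd] at hd
      rw [hd, zero_pow two_ne_zero, Finset.sum_eq_single_of_mem 0 (by simp [hp.pos])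
        (fun i _ hi => zero_pow hi)] at hsum
      simp at hsum
    have hne : (n : ZMod q) ^ 2 ≠ 1 := by
      intro h1
      simp only [h1, one_pow, Finset.sum_const, Finset.card_range, nsmul_eq_mul, mul_one] at hsum
      rw [ZMod.natCast_eq_zero_iff, Nat.prime_dvd_prime_iff_eq hq hp] at hsum
      exact hqn (hsum ▸ hpn)
    have hpow : ((n : ZMod q) ^ 2) ^ p = 1 := by
      have := geom_sum_mul ((n : ZMod q) ^ 2) p
      rw [hsum, zero_mul] at this
      exact (sub_eq_zero.1 this.symm)
    have hord : orderOf ((n : ZMod q) ^ 2) = p :=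
      have := Fact.mk hp
      orderOf_eq_prime hpow hne
    obtain ⟨G, _, hG, σ, hσ⟩ := dvd_orderOf_of_conjSep hn h hq hqn
    have : Finite G := hG.1
    refine hG.2.2 p hp (dvd_trans ?_ (orderOf_dvd_natCard (σ (BSt 1 n))))
    rw [← hord]
    refine dvd_trans (orderOf_pow_dvd 2) (orderOf_dvd_of_pow_eq_one ?_)
    have h1 := congrArg σ (zpow_mul_pow_of_semiconj (a_mul_t (n := n)) 1 (orderOf (σ (BSt 1 n))))
    rw [map_mul, map_mul, map_pow, pow_orderOf_eq_one, one_mul, mul_one, map_zpow, map_zpow,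
      zpow_eq_zpow_iff_modEq, one_mul] at h1
    have h2 := h1.of_dvd (Int.natCast_dvd_natCast.2 hσ)
    rw [← ZMod.intCast_eq_intCast_iff] at h2
    push_cast at h2
    exact h2.symm
  · obtain ⟨G, _, hG, σ, hσ⟩ := dvd_orderOf_of_conjSep hn h hp hpn
    exact hG.2.2 p hp (hσ.trans (orderOf_dvd_natCard _))

end BS

namespace IsRootClass

variable {C : GroupClass}

theorem of_subsingleton (hroot : IsRootClass C) (G : Type) [Group G] [Subsingleton G] : C G := by
  obtain ⟨X, _, hX, -⟩ := hroot.has_nontrivial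
  have := uniqueOfSubsingleton (1 : G)
  exact hroot.iso_closed (⊥ : Subgroup X) G MulEquiv.ofUnique (hroot.subgroup_closed X ⊥ hX)

theorem of_card_prime (hroot : IsRootClass C) (hper : PeriodicClass C) {p : ℕ}
    (hp : p ∈ PrimesOf C) (G : Type) [Group G] (hG : Nat.card G = p) : C G := by
  obtain ⟨hp', X, _, hX, g, hg⟩ := hp
  have := Fact.mk hp'
  have h0 : orderOf g ≠ 0 := (hper X hX g).orderOf_pos.ne'
  refine hroot.iso_closed (Subgroup.zpowers (g ^ (orderOf g / p))) G
    (mulEquivOfPrimeCardEq (p := p) ?_ hG) (hroot.subgroup_closed X _ hX)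
  rw [Nat.card_zpowers, orderOf_pow_orderOf_div h0 hg]

theorem of_fsClass (hroot : IsRootClass C) (hper : PeriodicClass C) (G : Type) [Group G]
    (hG : FSClass (PrimesOf C) G) : C G := by
  obtain ⟨hfin, (hsol : Group.IsSolvable G), hcard⟩ := hG
  induction hk : Nat.card G using Nat.strong_induction_on generalizing G with
  | _ k ih =>
  subst hk
  have hext : ∀ N : Subgroup G, N.Normal → N ≠ ⊥ → C N → C G := fun N _ hN hCN => by
    refine hroot.extension_closed G N hCN (ih _ ?_ (G ⧸ N) inferInstance
      (inferInstanceAs (Group.IsSolvable (G ⧸ N)))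
      (fun p hp hpd => hcard p hp (hpd.trans N.card_quotient_dvd_card)) rfl)
    rw [N.card_eq_card_quotient_mul_card_subgroup]
    exact lt_mul_of_one_lt_right Nat.card_pos ((Subgroup.one_lt_card_iff_ne_bot N).2 hN)
  rcases subsingleton_or_nontrivial G with _ | _
  · exact hroot.of_subsingleton G
  by_cases hcomm : commutator G = ⊥
  · have hc : ∀ a b : G, a * b = b * a := fun a b => by
      have := Subgroup.commutator_mem_commutator (Subgroup.mem_top a) (Subgroup.mem_top b)
      rw [← commutator_def, hcomm, Subgroup.mem_bot] at this
      exact commutatorElement_eq_one_iff_mul_comm.1 this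
    obtain ⟨p, hp, hpd⟩ := Nat.exists_prime_and_dvd (Finite.one_lt_card (α := G)).ne'
    have := Fact.mk hp
    obtain ⟨g, hg⟩ := exists_prime_orderOf_dvd_card' p hpd
    refine hext (Subgroup.zpowers g) ⟨fun x hx y => ?_⟩ ?_
      (hroot.of_card_prime hper (hcard p hp hpd) _ (by rw [Nat.card_zpowers, hg]))
    · rwa [hc y x, mul_inv_cancel_right]
    · rw [Ne, Subgroup.zpowers_eq_bot]
      rintro rfl
      exact hp.one_lt.ne (by rwa [orderOf_one] at hg)
  · refine hext _ inferInstance hcomm (ih _ ?_ _ inferInstance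
      (inferInstanceAs (Group.IsSolvable (commutator G)))
      (fun p hp hpd => hcard p hp (hpd.trans (Subgroup.card_subgroup_dvd_card _))) rfl)
    refine lt_of_le_of_ne (Subgroup.card_le_card_group _) fun h => ?_
    exact (Group.IsSolvable.commutator_lt_top_of_nontrivial G).ne (Subgroup.eq_top_of_card_eq _ h)

end IsRootClass

theorem BS.fsClass_of_surjective {C : GroupClass} (hper : PeriodicClass C) {n : ℤ} {G : Type}
    [Group G] (hG : C G) {σ : BS 1 n →* G} (hσ : Function.Surjective σ) :
    FSClass (PrimesOf C) G := by
  have hfin : Finite G := BS.finite_of_isOfFinOrder hσ (hper G hG)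
  refine ⟨hfin, Group.isSolvable_of_surjective hσ, fun p hp hpd => ⟨hp, G, _, hG, ?_⟩⟩
  have := Fact.mk hp
  obtain ⟨g, hg⟩ := exists_prime_orderOf_dvd_card' p hpd
  exact ⟨g, hg.symm.dvd⟩

/-- for `|n| ≥ 2`, `BS(1,n)` is conjugacy `𝒞`-separable iff it is conjugacy
`𝓕𝓢_{𝔓(𝒞)}`-separable iff `𝔓(𝒞)` contains all primes. -/
theorem stmt15 (C : GroupClass) (hroot : IsRootClass C) (hper : PeriodicClass C)
    (n : ℤ) (hn : 2 ≤ |n|) :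
    (ConjSep C (BS 1 n) ↔ ConjSep (FSClass (PrimesOf C)) (BS 1 n)) ∧
    (ConjSep (FSClass (PrimesOf C)) (BS 1 n) ↔ ∀ p : ℕ, p.Prime → p ∈ PrimesOf C) := by
  have hC : ConjSep C (BS 1 n) ↔ ConjSep (FSClass (PrimesOf C)) (BS 1 n) := by
    refine ⟨fun h x y hxy => ?_, fun h x y hxy => ?_⟩
    · obtain ⟨G, _, hG, σ, hσ, hc⟩ := h x y hxy
      exact ⟨G, _, BS.fsClass_of_surjective hper hG hσ, σ, hσ, hc⟩
    · obtain ⟨G, _, hG, σ, hσ, hc⟩ := h x y hxy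
      exact ⟨G, _, hroot.of_fsClass hper G hG, σ, hσ, hc⟩
  exact ⟨hC, fun h _ hp => BS.prime_mem_of_conjSep hn h hp, BS.conjSep_fsClass hn⟩
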